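/- arXiv:2604.24423 — 3 statements merged into one kernel-verified Lean document; each statement's English description precedes it below -/
import Mathlib

section
/- Let r := min{rank A, rank B}. The maximum of γ_{C_sep} over C_qm is achieved by the following correlations: (i) if r = 3, by C = A Q Bᵀ for every Q ∈ SO⁻(3), and the maximal value is 3; (ii) if r = 2 and (rank A = 3 or rank B = 3), by C = A Q Bᵀ for every Q ∈ SO⁻(3), and the maximal value is 2; (iii) if rank A = rank B = 2, by C = A Q Bᵀ for every Q ∈ SO⁻(3) with Q(col Bᵀ) = col Aᵀ, and the maximal value is 2. -/
open Matrix Kronecker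
open scoped ENNReal ComplexOrder

namespace BellCorr

/-- The three Pauli matrices. -/
noncomputable def pauli (k : Fin 3) : Matrix (Fin 2) (Fin 2) ℂ :=
  if k = 0 then !![0, 1; 1, 0]
  else if k = 1 then !![0, -Complex.I; Complex.I, 0]
  else !![1, 0; 0, -1]

/-- The observable `Â_i = ∑ k A i k • σ_k` associated with row `i` of `A`. -/
noncomputable def obs {m : ℕ} (A : Matrix (Fin m) (Fin 3) ℝ) (i : Fin m) :
    Matrix (Fin 2) (Fin 2) ℂ :=
  ∑ k : Fin 3, (A i k : ℂ) • pauli k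

/-- The correlation map `Φ_AB`, sending a 4×4 complex matrix to the real m×m matrix
with entries `Tr[ρ (Â_i ⊗ B̂_j)]`. -/
noncomputable def corr {m : ℕ} (A B : Matrix (Fin m) (Fin 3) ℝ)
    (ρ : Matrix (Fin 2 × Fin 2) (Fin 2 × Fin 2) ℂ) : Matrix (Fin m) (Fin m) ℝ :=
  Matrix.of fun i j => ((ρ * (obs A i ⊗ₖ obs B j)).trace).re

/-- Separable states: convex hull of products of 2×2 PSD trace-one matrices. -/
noncomputable def Ssep : Set (Matrix (Fin 2 × Fin 2) (Fin 2 × Fin 2) ℂ) :=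
  convexHull ℝ {ρ | ∃ ρA ρB : Matrix (Fin 2) (Fin 2) ℂ,
    ρA.PosSemidef ∧ ρA.trace = 1 ∧ ρB.PosSemidef ∧ ρB.trace = 1 ∧ ρ = ρA ⊗ₖ ρB}

/-- Quantum states: 4×4 PSD matrices of trace one. -/
def Sqm : Set (Matrix (Fin 2 × Fin 2) (Fin 2 × Fin 2) ℂ) :=
  {ρ | ρ.PosSemidef ∧ ρ.trace = 1}

/-- Maximal-tensor-product states: self-adjoint trace-one matrices pairing
nonnegatively with every product of PSD matrices. -/
def Smax : Set (Matrix (Fin 2 × Fin 2) (Fin 2 × Fin 2) ℂ) :=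
  {ρ | ρ.IsHermitian ∧ ρ.trace = 1 ∧
    ∀ P Q : Matrix (Fin 2) (Fin 2) ℂ, P.PosSemidef → Q.PosSemidef →
      0 ≤ ((ρ * (P ⊗ₖ Q)).trace).re}

noncomputable def Csep {m : ℕ} (A B : Matrix (Fin m) (Fin 3) ℝ) :
    Set (Matrix (Fin m) (Fin m) ℝ) := corr A B '' Ssep

noncomputable def Cqm {m : ℕ} (A B : Matrix (Fin m) (Fin 3) ℝ) :
    Set (Matrix (Fin m) (Fin m) ℝ) := corr A B '' Sqm

noncomputable def Cmax {m : ℕ} (A B : Matrix (Fin m) (Fin 3) ℝ) :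
    Set (Matrix (Fin m) (Fin m) ℝ) := corr A B '' Smax

/-- Support function `φ_K(Z) = sup_{C ∈ K} Tr[Zᵀ C]`. -/
noncomputable def suppFn {m : ℕ} (K : Set (Matrix (Fin m) (Fin m) ℝ))
    (Z : Matrix (Fin m) (Fin m) ℝ) : ℝ :=
  sSup ((fun C => (Zᵀ * C).trace) '' K)

/-- Gauge function `γ_K(C) = inf {t > 0 : C/t ∈ K}`, with value `+∞` if no such `t` exists. -/
noncomputable def gaugeFn {m : ℕ} (K : Set (Matrix (Fin m) (Fin m) ℝ))
    (C : Matrix (Fin m) (Fin m) ℝ) : ℝ≥0∞ :=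
  ⨅ (t : ℝ) (_ : 0 < t ∧ t⁻¹ • C ∈ K), ENNReal.ofReal t

/-- `XᵀX` is Hermitian for a real matrix `X`. -/
lemma isHermitian_tr_mul_self (X : Matrix (Fin 3) (Fin 3) ℝ) : (Xᵀ * X).IsHermitian := by
  simpa [Matrix.conjTranspose_eq_transpose_of_trivial] using
    Matrix.isHermitian_conjTranspose_mul_self X

/-- The singular values of a real 3×3 matrix, in decreasing order:
`sval X 0 ≥ sval X 1 ≥ sval X 2 ≥ 0` are the square roots of the eigenvalues of `XᵀX`. -/
noncomputable def sval (X : Matrix (Fin 3) (Fin 3) ℝ) (i : Fin 3) : ℝ :=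
  Real.sqrt ((isHermitian_tr_mul_self X).eigenvalues
    (Tuple.sort (isHermitian_tr_mul_self X).eigenvalues i.rev))

/-- Column space of a real matrix. -/
noncomputable def colSpace {m n : ℕ} (X : Matrix (Fin m) (Fin n) ℝ) :
    Submodule ℝ (Fin m → ℝ) := LinearMap.range X.mulVecLin

/-- `Y` is the Moore–Penrose pseudoinverse of `X`. -/
def IsMP {m n : ℕ} (X : Matrix (Fin m) (Fin n) ℝ) (Y : Matrix (Fin n) (Fin m) ℝ) : Prop :=
  X * Y * X = X ∧ Y * X * Y = Y ∧ (X * Y)ᵀ = X * Y ∧ (Y * X)ᵀ = Y * X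

/-- The traceless Hermitian matrix `∑ k, v k • σ_k` with Bloch vector `v`. -/
noncomputable def bloch (v : Fin 3 → ℝ) : Matrix (Fin 2) (Fin 2) ℂ :=
  ∑ k : Fin 3, (v k : ℂ) • pauli k

lemma bloch_eq (v : Fin 3 → ℝ) :
    bloch v = !![(v 2 : ℂ), v 0 - Complex.I * v 1; v 0 + Complex.I * v 1, -(v 2 : ℂ)] := by
  ext i j
  fin_cases i <;> fin_cases j <;> simp [bloch, Fin.sum_univ_three, pauli] <;> ring

lemma bloch_isHermitian (v : Fin 3 → ℝ) : (bloch v).IsHermitian := by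
  rw [bloch_eq]
  ext i j
  fin_cases i <;> fin_cases j <;> simp [sub_eq_add_neg]

lemma bloch_mul_self (v : Fin 3 → ℝ) : bloch v * bloch v = ((v ⬝ᵥ v : ℝ) : ℂ) • 1 := by
  rw [bloch_eq]
  ext i j
  fin_cases i <;> fin_cases j <;>
    simp [Matrix.mul_apply, dotProduct, Fin.sum_univ_three] <;> ring_nf <;>
    simp only [Complex.I_sq] <;> ring

lemma bloch_single (k : Fin 3) : bloch (Pi.single k 1) = pauli k := by
  simp [bloch, Pi.single_apply]

lemma trace_mul_re_le {n : Type*} [Fintype n] [DecidableEq n] {ρ S : Matrix n n ℂ}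
    (hρ : ρ.PosSemidef) (hS : S.IsHermitian) (hS2 : S * S = 1) :
    (ρ * S).trace.re ≤ ρ.trace.re := by
  have h := (hρ.mul_mul_conjTranspose_same (1 - S)).trace_nonneg
  have e : ((1 - S) * ρ * (1 - S)ᴴ).trace = 2 * ρ.trace - 2 * (ρ * S).trace := by
    rw [conjTranspose_sub, conjTranspose_one, hS.eq, Matrix.mul_assoc, trace_mul_comm, Matrix.mul_assoc]
    have : (1 - S) * (1 - S) = (2 : ℂ) • 1 - (2 : ℂ) • S := by
      rw [sub_mul, mul_sub, mul_sub, hS2, two_smul, two_smul]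
      simp only [one_mul, mul_one]
      abel
    rw [this, mul_sub, trace_sub, Matrix.mul_smul, Matrix.mul_smul, trace_smul, trace_smul, mul_one]
    simp
  rw [e] at h
  have := (Complex.le_def.1 h).1
  simp at this
  linarith

lemma dotProduct_self_le_one {v : Fin 3 → ℝ} (h : ∀ a : Fin 3 → ℝ, a ⬝ᵥ a = 1 → a ⬝ᵥ v ≤ 1) :
    v ⬝ᵥ v ≤ 1 := by
  by_contra! hc
  have h0 : 0 ≤ v ⬝ᵥ v := by linarith
  have hs : 1 < √(v ⬝ᵥ v) := Real.lt_sqrt_of_sq_lt (by simpa using hc)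
  have hss := Real.mul_self_sqrt h0
  set s := √(v ⬝ᵥ v)
  have := h (s⁻¹ • v) (by
    simp only [smul_dotProduct, dotProduct_smul, smul_eq_mul, ← hss]
    field_simp)
  simp only [smul_dotProduct, smul_eq_mul, ← hss] at this
  rw [inv_mul_cancel_left₀ (by linarith)] at this
  linarith

lemma dotProduct_self_nonneg {n : Type*} [Fintype n] (v : n → ℝ) : 0 ≤ v ⬝ᵥ v :=
  Finset.sum_nonneg fun _ _ => mul_self_nonneg _

lemma dotProduct_le_one {a v : Fin 3 → ℝ} (ha : a ⬝ᵥ a ≤ 1) (hv : v ⬝ᵥ v ≤ 1) :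
    a ⬝ᵥ v ≤ 1 := by
  have h : 0 ≤ (a - v) ⬝ᵥ (a - v) := dotProduct_self_nonneg _
  rw [sub_dotProduct, dotProduct_sub, dotProduct_sub, dotProduct_comm v a] at h
  linarith

/-- The correlation map as a real-linear map. -/
noncomputable def corrLin {m : ℕ} (A B : Matrix (Fin m) (Fin 3) ℝ) :
    Matrix (Fin 2 × Fin 2) (Fin 2 × Fin 2) ℂ →ₗ[ℝ] Matrix (Fin m) (Fin m) ℝ where
  toFun := corr A B
  map_add' x y := by ext; simp [corr, add_mul]
  map_smul' c x := by ext; simp [corr]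

/-- The 3×3 correlation matrix of a state. -/
noncomputable def corrMat (ρ : Matrix (Fin 2 × Fin 2) (Fin 2 × Fin 2) ℂ) :
    Matrix (Fin 3) (Fin 3) ℝ :=
  Matrix.of fun k l => ((ρ * (pauli k ⊗ₖ pauli l)).trace).re

lemma trace_mul_kronecker_bloch (ρ : Matrix (Fin 2 × Fin 2) (Fin 2 × Fin 2) ℂ)
    (a b : Fin 3 → ℝ) :
    ((ρ * (bloch a ⊗ₖ bloch b)).trace).re = a ⬝ᵥ corrMat ρ *ᵥ b := by
  simp only [bloch, corrMat, dotProduct, mulVec, Fin.sum_univ_three, add_kronecker, kronecker_add,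
    smul_kronecker, kronecker_smul, mul_add, trace_add, Matrix.mul_smul, trace_smul, smul_eq_mul,
    Complex.add_re, Complex.re_ofReal_mul, Matrix.of_apply]
  ring

lemma corr_eq {m : ℕ} (A B : Matrix (Fin m) (Fin 3) ℝ)
    (ρ : Matrix (Fin 2 × Fin 2) (Fin 2 × Fin 2) ℂ) : corr A B ρ = A * corrMat ρ * Bᵀ := by
  ext i j
  have h : corr A B ρ i j = A i ⬝ᵥ corrMat ρ *ᵥ B j := trace_mul_kronecker_bloch ρ (A i) (B j)
  rw [h, Matrix.mul_assoc]
  simp [mul_apply, dotProduct, mulVec]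

lemma mulVec_corrMat_le {ρ : Matrix (Fin 2 × Fin 2) (Fin 2 × Fin 2) ℂ} (hρ : ρ ∈ Sqm)
    {a b : Fin 3 → ℝ} (ha : a ⬝ᵥ a = 1) (hb : b ⬝ᵥ b = 1) : a ⬝ᵥ corrMat ρ *ᵥ b ≤ 1 := by
  rw [← trace_mul_kronecker_bloch]
  refine (trace_mul_re_le hρ.1 ?_ ?_).trans_eq (by simp [hρ.2])
  · rw [Matrix.IsHermitian, conjTranspose_kronecker, (bloch_isHermitian a).eq,
      (bloch_isHermitian b).eq]
  · rw [← mul_kronecker_mul, bloch_mul_self, bloch_mul_self, ha, hb]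
    simp

/-- The qubit state with Bloch vector `a`. -/
noncomputable def qubit (a : Fin 3 → ℝ) : Matrix (Fin 2) (Fin 2) ℂ :=
  (1 / 2 : ℝ) • (1 + bloch a)

lemma qubit_posSemidef {a : Fin 3 → ℝ} (ha : a ⬝ᵥ a ≤ 1) : (qubit a).PosSemidef := by
  have e : qubit a = (1 / 4 : ℝ) • ((1 + bloch a)ᴴ * (1 + bloch a))
      + ((1 - a ⬝ᵥ a) / 4 : ℝ) • (1 : Matrix (Fin 2) (Fin 2) ℂ) := by
    rw [conjTranspose_add, conjTranspose_one, (bloch_isHermitian a).eq, add_mul, mul_add, mul_add,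
      bloch_mul_self, qubit]
    simp only [one_mul, mul_one, Complex.coe_smul]
    module
  rw [e]
  exact ((posSemidef_conjTranspose_mul_self _).smul (by norm_num)).add
    (PosSemidef.one.smul (by linarith))

lemma qubit_trace (a : Fin 3 → ℝ) : (qubit a).trace = 1 := by
  simp [qubit, bloch_eq, trace_fin_two]

lemma trace_qubit_mul_pauli (a : Fin 3 → ℝ) (k : Fin 3) : (qubit a * pauli k).trace = a k := by
  rw [qubit, bloch_eq]
  fin_cases k <;> simp [pauli, trace_fin_two, mul_apply] <;> ring_nf; simp

lemma corrMat_qubit (a b : Fin 3 → ℝ) : corrMat (qubit a ⊗ₖ qubit b) = vecMulVec a b := by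
  ext k l
  simp [corrMat, ← mul_kronecker_mul, trace_kronecker, trace_qubit_mul_pauli, vecMulVec_apply]

lemma gaugeFn_le {m d : ℕ} (hd : 0 < d) (A B : Matrix (Fin m) (Fin 3) ℝ)
    (a b : Fin d → Fin 3 → ℝ) (ha : ∀ k, a k ⬝ᵥ a k ≤ 1) (hb : ∀ k, b k ⬝ᵥ b k ≤ 1) :
    gaugeFn (Csep A B) (A * (∑ k, vecMulVec (a k) (b k)) * Bᵀ) ≤ d := by
  have hd' : (0 : ℝ) < d := by exact_mod_cast hd
  refine iInf₂_le_of_le (d : ℝ) ⟨hd', ?_⟩ (by simp)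
  refine ⟨∑ k, (d : ℝ)⁻¹ • (qubit (a k) ⊗ₖ qubit (b k)), ?_, ?_⟩
  · refine (convex_convexHull ℝ _).sum_mem (fun _ _ => by positivity) ?_ fun k _ =>
      subset_convexHull ℝ _ ⟨_, _, qubit_posSemidef (ha k), qubit_trace _,
        qubit_posSemidef (hb k), qubit_trace _, rfl⟩
    simp [hd'.ne']
  · change corrLin A B _ = _
    rw [map_sum, Matrix.mul_sum, Matrix.sum_mul, Finset.smul_sum]
    refine Finset.sum_congr rfl fun k _ => ?_
    rw [map_smul]
    change _ • corr A B _ = _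
    rw [corr_eq, corrMat_qubit]

lemma corrMat_kronecker {ρA ρB : Matrix (Fin 2) (Fin 2) ℂ} (hA : ρA.IsHermitian) :
    corrMat (ρA ⊗ₖ ρB) =
      vecMulVec (fun k => (ρA * pauli k).trace.re) (fun l => (ρB * pauli l).trace.re) := by
  ext k l
  have him : (ρA * pauli k).trace.im = 0 := by
    have hk : (pauli k).IsHermitian := bloch_single k ▸ bloch_isHermitian _
    have : star (ρA * pauli k).trace = (ρA * pauli k).trace := by
      rw [← trace_conjTranspose, conjTranspose_mul, hA.eq, hk.eq, trace_mul_comm]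
    exact Complex.conj_eq_iff_im.1 this
  simp [corrMat, ← mul_kronecker_mul, trace_kronecker, vecMulVec_apply, him]

lemma dotProduct_trace_mul_pauli (ρ : Matrix (Fin 2) (Fin 2) ℂ) (u : Fin 3 → ℝ) :
    u ⬝ᵥ (fun k => (ρ * pauli k).trace.re) = (ρ * bloch u).trace.re := by
  simp [bloch, Matrix.mul_sum, trace_sum, dotProduct]

lemma blochVector_dotProduct_le {ρ : Matrix (Fin 2) (Fin 2) ℂ} (hρ : ρ.PosSemidef)
    (h1 : ρ.trace = 1) :
    (fun k => (ρ * pauli k).trace.re) ⬝ᵥ (fun k => (ρ * pauli k).trace.re) ≤ 1 := by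
  refine dotProduct_self_le_one fun u hu => ?_
  rw [dotProduct_trace_mul_pauli]
  exact (trace_mul_re_le hρ (bloch_isHermitian u)
    (by rw [bloch_mul_self, hu]; simp)).trans_eq (by simp [h1])

lemma trace_mul_corrMat_le {K : Matrix (Fin 3) (Fin 3) ℝ}
    (hK : ∀ v, (K *ᵥ v) ⬝ᵥ (K *ᵥ v) ≤ v ⬝ᵥ v)
    {ρ : Matrix (Fin 2 × Fin 2) (Fin 2 × Fin 2) ℂ} (hρ : ρ ∈ Ssep) :
    (Kᵀ * corrMat ρ).trace ≤ 1 := by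
  have hlin : IsLinearMap ℝ
      fun ρ : Matrix (Fin 2 × Fin 2) (Fin 2 × Fin 2) ℂ => (Kᵀ * corrMat ρ).trace := by
    have h (ρ) : corrMat ρ = corrLin 1 1 ρ := by
      change _ = corr 1 1 ρ
      simp [corr_eq]
    simp only [h]
    exact ((traceLinearMap (Fin 3) ℝ ℝ ∘ₗ LinearMap.mulLeft ℝ Kᵀ) ∘ₗ corrLin 1 1).isLinear
  refine convexHull_min (t := {ρ | (Kᵀ * corrMat ρ).trace ≤ 1}) ?_
    (convex_halfSpace_le hlin 1) hρ
  rintro _ ⟨ρA, ρB, hA, hA1, hB, hB1, rfl⟩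
  rw [Set.mem_ofPred_eq, corrMat_kronecker hA.1, mul_vecMulVec, trace_vecMulVec, mulVec_transpose,
    ← dotProduct_mulVec]
  exact dotProduct_le_one (blochVector_dotProduct_le hA hA1)
    ((hK _).trans (blochVector_dotProduct_le hB hB1))

lemma ofReal_le_gaugeFn {m : ℕ} (A B : Matrix (Fin m) (Fin 3) ℝ) {Q P R : Matrix (Fin 3) (Fin 3) ℝ}
    {G H : Matrix (Fin 3) (Fin m) ℝ} (hP : P = G * A) (hR : R = H * B)
    (hK : ∀ v, ((P * Q * Rᵀ) *ᵥ v) ⬝ᵥ ((P * Q * Rᵀ) *ᵥ v) ≤ v ⬝ᵥ v)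
    (hPP : Pᵀ * P = P) (hRR : Rᵀ * R = R) :
    ENNReal.ofReal (((P * Q * Rᵀ)ᵀ * (P * Q * Rᵀ)).trace) ≤
      gaugeFn (Csep A B) (A * Q * Bᵀ) := by
  refine le_iInf₂ fun t ⟨ht, ρ, hρ, he⟩ => ENNReal.ofReal_le_ofReal ?_
  have hPt : Pᵀ = P := by rw [← hPP]; simp
  have hRt : Rᵀ = R := by rw [← hRR]; simp
  have hP2 : P * P = P := by simpa only [hPt] using hPP
  have hR2 : R * R = R := by simpa only [hRt] using hRR
  have hX : P * Q * Rᵀ = t • (P * corrMat ρ * Rᵀ) := by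
    rw [corr_eq] at he
    have : A * Q * Bᵀ = t • (A * corrMat ρ * Bᵀ) := by rw [he, smul_inv_smul₀ ht.ne']
    calc P * Q * Rᵀ = G * (A * Q * Bᵀ) * Hᵀ := by
          rw [hP, hR, transpose_mul]; simp only [Matrix.mul_assoc]
      _ = t • (P * corrMat ρ * Rᵀ) := by
          rw [this, hP, hR, transpose_mul]; simp only [Matrix.mul_assoc, Matrix.mul_smul, Matrix.smul_mul]
  have h1 := trace_mul_corrMat_le hK hρ
  have h2 : ((P * Q * Rᵀ)ᵀ * (P * corrMat ρ * Rᵀ)).trace = ((P * Q * Rᵀ)ᵀ * corrMat ρ).trace := by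
    simp only [transpose_mul, hRt, hPt]
    rw [← Matrix.mul_assoc, trace_mul_comm]
    congr 1
    calc _ = (R * R) * Qᵀ * (P * P) * corrMat ρ := by simp only [Matrix.mul_assoc]
      _ = _ := by rw [hR2, hP2]; simp only [Matrix.mul_assoc]
  calc _ = t * ((P * Q * Rᵀ)ᵀ * corrMat ρ).trace := by
        rw [← h2, ← smul_eq_mul (a := t), ← trace_smul, ← Matrix.mul_smul, ← hX]
    _ ≤ t := mul_le_of_le_one_right ht.le h1

/-- An orthonormal basis of the row space, as the rows of `U`. -/
lemma exists_rowSpace_basis {m d : ℕ} (A : Matrix (Fin m) (Fin 3) ℝ) (hd : A.rank = d) :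
    ∃ (U : Matrix (Fin d) (Fin 3) ℝ) (G : Matrix (Fin d) (Fin m) ℝ),
      U * Uᵀ = 1 ∧ A * (Uᵀ * U) = A ∧ U = G * A := by
  let f : Fin m → EuclideanSpace ℝ (Fin 3) := fun i => WithLp.toLp 2 (A i)
  let S := Submodule.span ℝ (Set.range f)
  have hS : Module.finrank ℝ S = d := by
    rw [← hd, rank_eq_finrank_span_row]
    have : S = (Submodule.span ℝ (Set.range A.row)).map
        (WithLp.linearEquiv 2 ℝ (Fin 3 → ℝ)).symm.toLinearMap := by
      rw [Submodule.map_span, ← Set.range_comp]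
      rfl
    rw [this]
    exact LinearEquiv.finrank_map_eq _ _
  let b := (stdOrthonormalBasis ℝ S).reindex (finCongr hS)
  have hmem (k) : ∃ c : Fin m → ℝ, ∑ i, c i • f i = (b k : EuclideanSpace ℝ (Fin 3)) :=
    Submodule.mem_span_range_iff_exists_fun ℝ |>.1 (b k).2
  choose G hG using hmem
  refine ⟨Matrix.of fun k j => (b k : EuclideanSpace ℝ (Fin 3)) j, Matrix.of G, ?_, ?_, ?_⟩
  · ext k l
    have := orthonormal_iff_ite.1 b.orthonormal l k
    simp only [Submodule.coe_inner, PiLp.inner_apply, RCLike.inner_apply, conj_trivial] at this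
    simp only [mul_apply, of_apply, transpose_apply, this, one_apply, eq_comm]
  · ext i j
    have h := b.sum_repr' ⟨f i, Submodule.subset_span ⟨i, rfl⟩⟩
    have h2 := congrArg (fun x : S => (x : EuclideanSpace ℝ (Fin 3)) j) h
    simp only [Submodule.coe_sum, Submodule.coe_smul, Submodule.coe_inner, PiLp.inner_apply,
      RCLike.inner_apply, conj_trivial, WithLp.ofLp_sum, Finset.sum_apply, PiLp.smul_apply,
      smul_eq_mul] at h2
    rw [← Matrix.mul_assoc, mul_apply]
    simpa [mul_apply, f] using h2
  · ext k j
    have := congrArg (fun x : EuclideanSpace ℝ (Fin 3) => x j) (hG k)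
    simpa [mul_apply, f] using this.symm

lemma gaugeFn_le_left {m d : ℕ} (hd : 0 < d) (A B : Matrix (Fin m) (Fin 3) ℝ) (hA : A.rank = d)
    {C : Matrix (Fin m) (Fin m) ℝ} (hC : C ∈ Cqm A B) : gaugeFn (Csep A B) C ≤ d := by
  obtain ⟨ρ, hρ, rfl⟩ := hC
  obtain ⟨U, G, h1, h2, h3⟩ := exists_rowSpace_basis A hA
  have hU (k) : U k ⬝ᵥ U k = 1 := by
    simpa [mul_apply, dotProduct] using congrFun (congrFun h1 k) k
  convert gaugeFn_le hd A B U (U * corrMat ρ) (fun k => (hU k).le) fun k => ?_ using 2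
  · have : ∑ k, vecMulVec (U k) ((U * corrMat ρ) k) = Uᵀ * U * corrMat ρ := by
      ext i j
      rw [Matrix.mul_assoc]
      simp [Matrix.sum_apply, vecMulVec_apply, mul_apply (M := Uᵀ)]
    rw [corr_eq, this, ← Matrix.mul_assoc A, h2]
  · refine dotProduct_self_le_one fun u hu => ?_
    have : u ⬝ᵥ (U * corrMat ρ) k = U k ⬝ᵥ corrMat ρ *ᵥ u := by
      rw [dotProduct_mulVec, dotProduct_comm]
      rfl
    rw [this]
    exact mulVec_corrMat_le hρ (hU k) hu

lemma gaugeFn_le_right {m d : ℕ} (hd : 0 < d) (A B : Matrix (Fin m) (Fin 3) ℝ) (hB : B.rank = d)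
    {C : Matrix (Fin m) (Fin m) ℝ} (hC : C ∈ Cqm A B) : gaugeFn (Csep A B) C ≤ d := by
  obtain ⟨ρ, hρ, rfl⟩ := hC
  obtain ⟨U, G, h1, h2, h3⟩ := exists_rowSpace_basis B hB
  have hU (k) : U k ⬝ᵥ U k = 1 := by
    simpa [mul_apply, dotProduct] using congrFun (congrFun h1 k) k
  convert gaugeFn_le hd A B (fun k => corrMat ρ *ᵥ U k) U (fun k => ?_) (fun k => (hU k).le)
    using 2
  · have : ∑ k, vecMulVec (corrMat ρ *ᵥ U k) (U k) = corrMat ρ * (Uᵀ * U) := by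
      ext i j
      rw [← Matrix.mul_assoc]
      simp only [Matrix.sum_apply, vecMulVec_apply, mul_apply (N := U)]
      rfl
    have h2' : Uᵀ * U * Bᵀ = Bᵀ := by
      simpa [transpose_mul] using congrArg transpose h2
    rw [corr_eq, this, Matrix.mul_assoc, Matrix.mul_assoc, Matrix.mul_assoc, h2']
  · exact dotProduct_self_le_one fun u hu => mulVec_corrMat_le hρ hu (hU k)

/-- The orthogonal projection onto the row space. -/
lemma exists_rowSpace_proj {m d : ℕ} (A : Matrix (Fin m) (Fin 3) ℝ) (hd : A.rank = d) :
    ∃ (P : Matrix (Fin 3) (Fin 3) ℝ) (G : Matrix (Fin 3) (Fin m) ℝ),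
      Pᵀ * P = P ∧ A * P = A ∧ P = G * A ∧ P.trace = d ∧ (d = 3 → P = 1) := by
  obtain ⟨U, G, h1, h2, h3⟩ := exists_rowSpace_basis A hd
  refine ⟨Uᵀ * U, Uᵀ * G, ?_, h2, by rw [Matrix.mul_assoc, ← h3], ?_, ?_⟩
  · calc _ = Uᵀ * (U * Uᵀ) * U := by simp [Matrix.mul_assoc]
      _ = _ := by simp [h1]
  · rw [trace_mul_comm, h1]; simp
  · rintro rfl
    exact mul_eq_one_comm.1 h1

lemma proj_mulVec_le {P : Matrix (Fin 3) (Fin 3) ℝ} (h : Pᵀ * P = P) (v : Fin 3 → ℝ) :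
    (P *ᵥ v) ⬝ᵥ (P *ᵥ v) ≤ v ⬝ᵥ v := by
  have h0 : 0 ≤ (v - P *ᵥ v) ⬝ᵥ (v - P *ᵥ v) := dotProduct_self_nonneg _
  have h1 : (P *ᵥ v) ⬝ᵥ (P *ᵥ v) = v ⬝ᵥ P *ᵥ v := by
    conv_rhs => rw [← h]
    rw [← mulVec_mulVec, dotProduct_mulVec v, vecMul_transpose]
  rw [sub_dotProduct, dotProduct_sub, dotProduct_sub, dotProduct_comm (P *ᵥ v) v, h1] at h0
  linarith

lemma proj_mul_orthogonal_mul_proj_le {P Q R : Matrix (Fin 3) (Fin 3) ℝ} (hP : Pᵀ * P = P)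
    (hQ : Qᵀ * Q = 1) (hR : Rᵀ * R = R) (v : Fin 3 → ℝ) :
    ((P * Q * Rᵀ) *ᵥ v) ⬝ᵥ ((P * Q * Rᵀ) *ᵥ v) ≤ v ⬝ᵥ v := by
  have hRt : Rᵀ = R := by rw [← hR]; simp
  rw [hRt, ← mulVec_mulVec, ← mulVec_mulVec]
  refine (proj_mulVec_le hP _).trans ?_
  rw [dotProduct_mulVec, ← mulVec_transpose, mulVec_mulVec, hQ, one_mulVec]
  exact proj_mulVec_le hR v

/-- Four times the quantum state with correlation matrix `Q`, minus the identity. -/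
noncomputable def corrOp (Q : Matrix (Fin 3) (Fin 3) ℝ) :
    Matrix (Fin 2 × Fin 2) (Fin 2 × Fin 2) ℂ :=
  ∑ k, pauli k ⊗ₖ bloch (Q k)

lemma corrOp_isHermitian (Q : Matrix (Fin 3) (Fin 3) ℝ) : (corrOp Q).IsHermitian := by
  have hk (k) : (pauli k).IsHermitian := bloch_single k ▸ bloch_isHermitian _
  rw [Matrix.IsHermitian, corrOp, conjTranspose_sum]
  exact Finset.sum_congr rfl fun k _ => by
    rw [conjTranspose_kronecker, (hk k).eq, (bloch_isHermitian _).eq]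

lemma trace_pauli (k : Fin 3) : (pauli k).trace = 0 := by
  fin_cases k <;> simp [pauli, trace_fin_two]

lemma trace_pauli_mul_pauli (k l : Fin 3) :
    (pauli k * pauli l).trace = if k = l then 2 else 0 := by
  fin_cases k <;> fin_cases l <;> simp [pauli, trace_fin_two] <;> norm_num

lemma trace_bloch_mul_pauli (v : Fin 3 → ℝ) (l : Fin 3) :
    (bloch v * pauli l).trace = 2 * v l := by
  simp [bloch, Matrix.sum_mul, trace_sum, trace_pauli_mul_pauli, mul_comm]

lemma corrMat_corrOp (Q : Matrix (Fin 3) (Fin 3) ℝ) :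
    corrMat ((1 / 4 : ℝ) • (1 + corrOp Q)) = Q := by
  ext k l
  rw [corrMat, of_apply, Matrix.smul_mul, trace_smul, add_mul, trace_add, one_mul, trace_kronecker,
    trace_pauli, corrOp, Matrix.sum_mul, trace_sum]
  simp [← mul_kronecker_mul, trace_kronecker, trace_pauli_mul_pauli, trace_bloch_mul_pauli]
  ring

lemma corrOp_mul_self {Q : Matrix (Fin 3) (Fin 3) ℝ} (hQ : Qᵀ * Q = 1) (hdet : Q.det = -1) :
    corrOp Q * corrOp Q = (3 : ℝ) • 1 + (2 : ℝ) • corrOp Q := by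
  have hQ' : Q * Qᵀ = 1 := mul_eq_one_comm.1 hQ
  have hadj : Q.adjugate = -Qᵀ := by
    calc Q.adjugate = Q.adjugate * (Q * Qᵀ) := by rw [hQ', mul_one]
      _ = _ := by rw [← Matrix.mul_assoc, adjugate_mul, hdet]; simp
  rw [adjugate_fin_three] at hadj
  simp only [← Matrix.ext_iff, Fin.forall_fin_succ, mul_apply, Fin.sum_univ_three] at hQ hQ' hadj
  simp [one_apply] at hQ hQ' hadj
  obtain ⟨⟨_, _, _⟩, ⟨_, _, _⟩, _, _, _⟩ := hQ
  obtain ⟨⟨_, _, _⟩, ⟨_, _, _⟩, _, _, _⟩ := hQ'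
  obtain ⟨⟨_, _, _⟩, ⟨_, _, _⟩, _, _, _⟩ := hadj
  ext ⟨i, j⟩ ⟨i', j'⟩
  fin_cases i <;> fin_cases j <;> fin_cases i' <;> fin_cases j' <;>
  simp [corrOp, bloch_eq, pauli, mul_apply, one_apply, Fin.sum_univ_three, Fintype.sum_prod_type] <;>
  apply Complex.ext <;> simp <;> linarith

lemma orthogonal_mem_Cqm {m : ℕ} (A B : Matrix (Fin m) (Fin 3) ℝ) {Q : Matrix (Fin 3) (Fin 3) ℝ}
    (hQ : Qᵀ * Q = 1) (hdet : Q.det = -1) : A * Q * Bᵀ ∈ Cqm A B := by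
  refine ⟨(1 / 4 : ℝ) • (1 + corrOp Q), ⟨?_, ?_⟩, by rw [corr_eq, corrMat_corrOp]⟩
  · have e : (1 / 4 : ℝ) • (1 + corrOp Q) = (1 / 16 : ℝ) • ((1 + corrOp Q)ᴴ * (1 + corrOp Q)) := by
      rw [conjTranspose_add, conjTranspose_one, (corrOp_isHermitian Q).eq, add_mul, mul_add,
        mul_add, corrOp_mul_self hQ hdet, one_mul, one_mul, mul_one]
      module
    rw [e]
    exact (posSemidef_conjTranspose_mul_self _).smul (by norm_num)
  · rw [trace_smul, trace_add, corrOp, trace_sum]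
    simp [trace_kronecker, trace_pauli]

lemma gaugeFn_orthogonal_ge {m : ℕ} (A B : Matrix (Fin m) (Fin 3) ℝ)
    {P Q R : Matrix (Fin 3) (Fin 3) ℝ} {G H : Matrix (Fin 3) (Fin m) ℝ} (hP : P = G * A)
    (hR : R = H * B) (hPP : Pᵀ * P = P) (hRR : Rᵀ * R = R) (hQ : Qᵀ * Q = 1)
    (hPQR : P * Q * R = Q * R) :
    ENNReal.ofReal R.trace ≤ gaugeFn (Csep A B) (A * Q * Bᵀ) := by
  have hRt : Rᵀ = R := by rw [← hRR]; simp
  convert ofReal_le_gaugeFn A B hP hR (proj_mul_orthogonal_mul_proj_le hPP hQ hRR) hPP hRR using 3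
  rw [hRt, hPQR, transpose_mul, hRt]
  calc R = Rᵀ * R := hRR.symm
    _ = R * (Qᵀ * Q) * R := by rw [hRt, hQ, mul_one]
    _ = _ := by simp only [Matrix.mul_assoc]

lemma gaugeFn_orthogonal_ge_left {m : ℕ} (A B : Matrix (Fin m) (Fin 3) ℝ)
    {P Q : Matrix (Fin 3) (Fin 3) ℝ} {G H : Matrix (Fin 3) (Fin m) ℝ} (hP : P = G * A)
    (hB : 1 = H * B) (hPP : Pᵀ * P = P) (hQ : Qᵀ * Q = 1) :
    ENNReal.ofReal P.trace ≤ gaugeFn (Csep A B) (A * Q * Bᵀ) := by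
  have h1 : (1 : Matrix (Fin 3) (Fin 3) ℝ)ᵀ * 1 = 1 := by simp
  convert ofReal_le_gaugeFn A B hP hB (proj_mul_orthogonal_mul_proj_le hPP hQ h1) hPP h1 using 2
  rw [transpose_one, mul_one, transpose_mul, trace_mul_comm]
  calc P.trace = (Pᵀ * (P * (Q * Qᵀ))).trace := by rw [mul_eq_one_comm.1 hQ, mul_one, hPP]
    _ = _ := by rw [trace_mul_comm]; simp only [Matrix.mul_assoc]

/-- Maximizers of `γ_{C_sep}` over `C_qm`. -/
theorem stmt14 {m : ℕ} (hm : 1 ≤ m) (A B : Matrix (Fin m) (Fin 3) ℝ)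
    (hA : ∀ i, ∑ k, A i k ^ 2 = 1) (hB : ∀ i, ∑ k, B i k ^ 2 = 1) :
    (min A.rank B.rank = 3 →
      (∀ C ∈ Cqm A B, gaugeFn (Csep A B) C ≤ 3) ∧
      (∀ Q : Matrix (Fin 3) (Fin 3) ℝ, Qᵀ * Q = 1 → Q.det = -1 →
        A * Q * Bᵀ ∈ Cqm A B ∧ gaugeFn (Csep A B) (A * Q * Bᵀ) = 3)) ∧
    (min A.rank B.rank = 2 → A.rank = 3 ∨ B.rank = 3 →
      (∀ C ∈ Cqm A B, gaugeFn (Csep A B) C ≤ 2) ∧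
      (∀ Q : Matrix (Fin 3) (Fin 3) ℝ, Qᵀ * Q = 1 → Q.det = -1 →
        A * Q * Bᵀ ∈ Cqm A B ∧ gaugeFn (Csep A B) (A * Q * Bᵀ) = 2)) ∧
    (A.rank = 2 → B.rank = 2 →
      (∀ C ∈ Cqm A B, gaugeFn (Csep A B) C ≤ 2) ∧
      (∀ Q : Matrix (Fin 3) (Fin 3) ℝ, Qᵀ * Q = 1 → Q.det = -1 →
        Submodule.map Q.mulVecLin (colSpace Bᵀ) = colSpace Aᵀ →
        A * Q * Bᵀ ∈ Cqm A B ∧ gaugeFn (Csep A B) (A * Q * Bᵀ) = 2)) := by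
  have hA3 : A.rank ≤ 3 := A.rank_le_width
  have hB3 : B.rank ≤ 3 := B.rank_le_width
  obtain ⟨P, G, hPP, hAP, hPG, hPt, hP1⟩ := exists_rowSpace_proj A rfl
  obtain ⟨R, H, hRR, hBR, hRH, hRt, hR1⟩ := exists_rowSpace_proj B rfl
  refine ⟨fun h => ?_, fun h h' => ?_, fun hA2 hB2 => ?_⟩
  · have hAr : A.rank = 3 := by omega
    have hBr : B.rank = 3 := by omega
    have hle : ∀ C ∈ Cqm A B, gaugeFn (Csep A B) C ≤ 3 := fun C hC =>
      mod_cast gaugeFn_le_left (by norm_num) A B hAr hC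
    refine ⟨hle, fun Q hQ hdet => ?_⟩
    have hmem := orthogonal_mem_Cqm A B hQ hdet
    refine ⟨hmem, (hle _ hmem).antisymm ?_⟩
    have := gaugeFn_orthogonal_ge A B hPG hRH hPP hRR hQ (by rw [hP1 hAr, one_mul])
    simpa [hRt, hBr] using this
  · have hle : ∀ C ∈ Cqm A B, gaugeFn (Csep A B) C ≤ 2 := by
      intro C hC
      rcases (by omega : A.rank = 2 ∨ B.rank = 2) with hr | hr
      · exact_mod_cast gaugeFn_le_left (by norm_num) A B hr hC
      · exact_mod_cast gaugeFn_le_right (by norm_num) A B hr hC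
    refine ⟨hle, fun Q hQ hdet => ?_⟩
    have hmem := orthogonal_mem_Cqm A B hQ hdet
    refine ⟨hmem, (hle _ hmem).antisymm ?_⟩
    rcases h' with hr | hr
    · have := gaugeFn_orthogonal_ge A B hPG hRH hPP hRR hQ (by rw [hP1 hr, one_mul])
      simpa [hRt, (by omega : B.rank = 2)] using this
    · have := gaugeFn_orthogonal_ge_left A B hPG (hR1 hr ▸ hRH) hPP hQ
      simpa [hPt, (by omega : A.rank = 2)] using this
  · have hle : ∀ C ∈ Cqm A B, gaugeFn (Csep A B) C ≤ 2 := fun C hC =>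
      mod_cast gaugeFn_le_left (by norm_num) A B hA2 hC
    refine ⟨hle, fun Q hQ hdet hcol => ?_⟩
    have hmem := orthogonal_mem_Cqm A B hQ hdet
    refine ⟨hmem, (hle _ hmem).antisymm ?_⟩
    have hPt' : Pᵀ = P := by rw [← hPP]; simp
    have hPA : P * Aᵀ = Aᵀ := by
      simpa [transpose_mul, hPt'] using congrArg transpose hAP
    have hRB : R = Bᵀ * Hᵀ := by
      rw [← transpose_mul, ← hRH, ← hRR]; simp
    have hPQR : P * Q * R = Q * R := by
      refine Matrix.ext_of_mulVec_single fun k => ?_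
      have hv : (Q * R) *ᵥ Pi.single k 1 ∈ colSpace Aᵀ := by
        rw [← hcol, hRB, ← mulVec_mulVec, ← mulVec_mulVec]
        exact Submodule.mem_map_of_mem ⟨_, rfl⟩
      obtain ⟨w, hw⟩ := hv
      rw [Matrix.mul_assoc, ← mulVec_mulVec, ← hw, mulVecLin_apply, mulVec_mulVec, hPA]
    have := gaugeFn_orthogonal_ge A B hPG hRH hPP hRR hQ hPQR
    simpa [hRt, hB2] using this

end BellCorr
end

section
/- (Duality of the asymmetric norms) For every real 3×3 matrix X: ‖X‖_+ = sup over nonzero real 3×3 matrices Y of Tr[Xᵀ Y] / ‖Y‖_−, and ‖X‖_− = sup over nonzero real 3×3 matrices Y of Tr[Xᵀ Y] / ‖Y‖_+. -/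
open Matrix Kronecker
open scoped ENNReal ComplexOrder

namespace BellCorr

/-- The asymmetric norm `‖X‖₊ = s₁ + s₂ + s₃·sgn(det X)`. -/
noncomputable def normPlus (X : Matrix (Fin 3) (Fin 3) ℝ) : ℝ :=
  sval X 0 + sval X 1 + Real.sign X.det * sval X 2

/-- The asymmetric norm `‖X‖₋ = s₁ + s₂ − s₃·sgn(det X)`. -/
noncomputable def normMinus (X : Matrix (Fin 3) (Fin 3) ℝ) : ℝ :=
  sval X 0 + sval X 1 - Real.sign X.det * sval X 2

lemma transpose_mem_specialOrthogonalGroup {n : Type*} [Fintype n] [DecidableEq n]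
    {Q : Matrix n n ℝ} (hQ : Q ∈ specialOrthogonalGroup n ℝ) :
    Qᵀ ∈ specialOrthogonalGroup n ℝ := by
  rw [mem_specialOrthogonalGroup_iff, mem_orthogonalGroup_iff'] at hQ
  rw [mem_specialOrthogonalGroup_iff, mem_orthogonalGroup_iff]
  simpa [star_eq_conjTranspose] using hQ

lemma diagonal_mem_specialOrthogonalGroup {n : Type*} [Fintype n] [DecidableEq n] {d : n → ℝ}
    (hd : ∀ i, d i * d i = 1) (hp : ∏ i, d i = 1) :
    diagonal d ∈ specialOrthogonalGroup n ℝ := by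
  rw [mem_specialOrthogonalGroup_iff, mem_orthogonalGroup_iff, det_diagonal]
  simp [hd, hp]

/-- A rotation of three-dimensional space has trace at least `-1`. -/
lemma neg_one_le_trace {Q : Matrix (Fin 3) (Fin 3) ℝ}
    (hQ : Q ∈ specialOrthogonalGroup (Fin 3) ℝ) : -1 ≤ Q.trace := by
  obtain ⟨h1, h2⟩ := mem_specialOrthogonalGroup_iff.1 hQ
  have hr : Q * Qᵀ = 1 := (mem_orthogonalGroup_iff _ _).1 h1
  have hc : Qᵀ * Q = 1 := (mem_orthogonalGroup_iff' _ _).1 h1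
  have ha : Q.adjugate = Qᵀ := by
    calc Q.adjugate = Qᵀ * Q * Q.adjugate := by rw [hc, one_mul]
      _ = Qᵀ := by rw [mul_assoc, mul_adjugate, h2, one_smul, mul_one]
  have r := fun i => congrFun (congrFun hr i) i
  have c := fun i => congrFun (congrFun hc i) i
  have a := fun i => congrFun (congrFun ha i) i
  have r0 := r 0
  have r1 := r 1
  have r2 := r 2
  have c0 := c 0
  have c1 := c 1
  have c2 := c 2
  have a0 := a 0
  have a1 := a 1
  have a2 := a 2
  simp [mul_apply, Fin.sum_univ_three, adjugate_fin_three] at r0 r1 r2 c0 c1 c2 a0 a1 a2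
  rw [trace_fin_three]
  have p0 : (1 + (Q 0 0 + Q 1 1 + Q 2 2)) * (1 + Q 0 0 - Q 1 1 - Q 2 2) = (Q 1 2 - Q 2 1) ^ 2 := by
    linear_combination -2 * a0 - r1 - r2 + c0
  have p1 : (1 + (Q 0 0 + Q 1 1 + Q 2 2)) * (1 + Q 1 1 - Q 0 0 - Q 2 2) = (Q 0 2 - Q 2 0) ^ 2 := by
    linear_combination -2 * a1 - r0 - r2 + c1
  have p2 : (1 + (Q 0 0 + Q 1 1 + Q 2 2)) * (1 + Q 2 2 - Q 1 1 - Q 0 0) = (Q 0 1 - Q 1 0) ^ 2 := by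
    linear_combination -2 * a2 - r0 - r1 + c2
  nlinarith [sq_nonneg (Q 1 2 - Q 2 1), sq_nonneg (Q 0 2 - Q 2 0), sq_nonneg (Q 0 1 - Q 1 0)]

lemma trace_diagonal_mul_le {a b c : ℝ} (hab : b ≤ a) (hbc : |c| ≤ b)
    {Q : Matrix (Fin 3) (Fin 3) ℝ} (hQ : Q ∈ specialOrthogonalGroup (Fin 3) ℝ) :
    (diagonal ![a, b, c] * Q).trace ≤ a + b + c := by
  have hle (i : Fin 3) : Q i i ≤ 1 :=
    (le_abs_self _).trans (entry_norm_bound_of_unitary (mem_specialOrthogonalGroup_iff.1 hQ).1 i i)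
  have hD : diagonal ![(-1 : ℝ), -1, 1] ∈ specialOrthogonalGroup (Fin 3) ℝ :=
    diagonal_mem_specialOrthogonalGroup (by simp [Fin.forall_fin_succ])
      (by simp [Fin.prod_univ_three])
  have ht := neg_one_le_trace (mul_mem hD hQ)
  obtain ⟨h1, h2⟩ := abs_le.1 hbc
  simp only [trace_fin_three, diagonal_mul, cons_val] at ht ⊢
  nlinarith [hle 0, hle 1, hle 2, mul_le_mul_of_nonneg_left (hle 0) (sub_nonneg.2 hab),
    mul_nonneg (sub_nonneg.2 h2) (by linarith : 0 ≤ 1 - (Q 0 0 + Q 1 1 - Q 2 2)),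
    mul_nonneg (by linarith : 0 ≤ b + c)
      (by linarith [hle 0, hle 1, hle 2] : 0 ≤ 3 - (Q 0 0 + Q 1 1 + Q 2 2))]

/-- A matrix whose columns are orthogonal is an orthogonal matrix times a diagonal one. -/
lemma exists_orthogonal_mul_diagonal {n : Type*} [Fintype n] [DecidableEq n]
    (Z : Matrix n n ℝ) (s : n → ℝ) (h : Zᵀ * Z = diagonal fun i => s i ^ 2) :
    ∃ B ∈ orthogonalGroup n ℝ, Z = B * diagonal s := by
  have hent (i j : n) : ∑ k, Z k i * Z k j = if i = j then s i ^ 2 else 0 := by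
    have := congrFun (congrFun h i) j
    rwa [diagonal_apply, mul_apply] at this
  let v : n → EuclideanSpace ℝ n := fun j => WithLp.toLp 2 fun i => Z i j / s j
  have hv : Orthonormal ℝ ({j | s j ≠ 0}.domRestrict v) := by
    rw [orthonormal_iff_ite]
    rintro ⟨i, hi⟩ ⟨j, hj⟩
    have h1 : inner ℝ (v i) (v j) = (∑ k, Z k i * Z k j) / (s i * s j) := by
      simp only [v, PiLp.inner_apply, Finset.sum_div]
      refine Finset.sum_congr rfl fun k _ => ?_
      simp only [RCLike.inner_apply, conj_trivial]
      ring
    change inner ℝ (v i) (v j) = _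
    rw [h1, hent]
    by_cases hij : i = j
    · subst hij
      have : s i ≠ 0 := hi
      simp
      field_simp
    · simp [hij]
  obtain ⟨b, hb⟩ := hv.exists_orthonormalBasis_extension_of_card_eq (by simp)
  refine ⟨(EuclideanSpace.basisFun n ℝ).toBasis.toMatrix b.toBasis,
    (EuclideanSpace.basisFun n ℝ).toMatrix_orthonormalBasis_mem_unitary b, ?_⟩
  ext i j
  simp only [mul_diagonal, Module.Basis.toMatrix_apply, OrthonormalBasis.coe_toBasis,
    OrthonormalBasis.coe_toBasis_repr_apply, EuclideanSpace.basisFun_repr]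
  by_cases hj : s j = 0
  · have h0 := hent j j
    simp only [hj, if_true, ne_eq, OfNat.ofNat_ne_zero, not_false_eq_true, zero_pow] at h0
    rw [Finset.sum_eq_zero_iff_of_nonneg fun k _ => mul_self_nonneg _] at h0
    simpa [hj] using h0 i (Finset.mem_univ i)
  · rw [hb j hj]
    simp [v, hj]

lemma transpose_mul_self_eigenvalues_nonneg (X : Matrix (Fin 3) (Fin 3) ℝ) (i : Fin 3) :
    0 ≤ (isHermitian_tr_mul_self X).eigenvalues i :=
  Matrix.PosSemidef.eigenvalues_nonneg
    (by simpa using Matrix.posSemidef_conjTranspose_mul_self X) i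

lemma sval_antitone (X : Matrix (Fin 3) (Fin 3) ℝ) : Antitone (sval X) := fun _ _ hij =>
  Real.sqrt_le_sqrt (Tuple.monotone_sort (isHermitian_tr_mul_self X).eigenvalues
    (Fin.rev_le_rev.2 hij))

lemma exists_orthogonal_transpose_mul_self (X : Matrix (Fin 3) (Fin 3) ℝ) :
    ∃ W ∈ orthogonalGroup (Fin 3) ℝ, (X * W)ᵀ * (X * W) = diagonal fun i => sval X i ^ 2 := by
  let h := isHermitian_tr_mul_self X
  let p : Equiv.Perm (Fin 3) := Fin.revPerm.trans (Tuple.sort h.eigenvalues)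
  let E : Matrix (Fin 3) (Fin 3) ℝ := h.eigenvectorUnitary
  have hE : Eᵀ * E = 1 := (mem_orthogonalGroup_iff' _ _).1 h.eigenvectorUnitary.2
  have hd : Eᵀ * (Xᵀ * X) * E = diagonal h.eigenvalues := by
    have := h.conjStarAlgAut_star_eigenvectorUnitary
    rw [Unitary.conjStarAlgAut_star_apply] at this
    simpa [star_eq_conjTranspose] using this
  refine ⟨E.submatrix id p, ?_, ?_⟩
  · rw [mem_orthogonalGroup_iff']
    change (E.submatrix id p)ᵀ * E.submatrix id p = 1
    rw [transpose_submatrix, ← submatrix_mul _ _ _ _ _ Function.bijective_id, hE,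
      submatrix_one_equiv]
  · have hXE : X * E.submatrix id p = (X * E).submatrix id p := by
      ext i j
      simp [mul_apply]
    rw [hXE, transpose_submatrix, ← submatrix_mul _ _ _ _ _ Function.bijective_id, transpose_mul,
      show Eᵀ * Xᵀ * (X * E) = Eᵀ * (Xᵀ * X) * E by simp only [Matrix.mul_assoc], hd,
      submatrix_diagonal_equiv]
    congr 1
    funext i
    exact (Real.sq_sqrt (transpose_mul_self_eigenvalues_nonneg X _)).symm

lemma mul_diagonal_det_mem {B : Matrix (Fin 3) (Fin 3) ℝ} (hB : B ∈ orthogonalGroup (Fin 3) ℝ)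
    (hdet : B.det * B.det = 1) :
    B * diagonal ![1, 1, B.det] ∈ specialOrthogonalGroup (Fin 3) ℝ := by
  rw [mem_specialOrthogonalGroup_iff]
  refine ⟨mul_mem hB ?_, by simp [Fin.prod_univ_three, hdet]⟩
  rw [mem_orthogonalGroup_iff, diagonal_transpose, diagonal_mul_diagonal, ← diagonal_one]
  congr 1
  ext i
  fin_cases i <;> simp [hdet]

/-- Singular value decomposition with rotations, the last singular value carrying the sign of the
determinant. -/
lemma exists_rotation_svd (X : Matrix (Fin 3) (Fin 3) ℝ) :
    ∃ U ∈ specialOrthogonalGroup (Fin 3) ℝ, ∃ V ∈ specialOrthogonalGroup (Fin 3) ℝ,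
      ∃ a b c : ℝ, b ≤ a ∧ |c| ≤ b ∧ X = U * diagonal ![a, b, c] * V ∧
        normPlus X = a + b + c ∧ normMinus X = a + b - c := by
  obtain ⟨W, hW, hXW⟩ := exists_orthogonal_transpose_mul_self X
  obtain ⟨B, hB, hXB⟩ := exists_orthogonal_mul_diagonal _ _ hXW
  have hdet {M : Matrix (Fin 3) (Fin 3) ℝ} (hM : M ∈ orthogonalGroup (Fin 3) ℝ) :
      M.det * M.det = 1 := by
    simpa using congrArg det ((mem_orthogonalGroup_iff' _ _).1 hM : Mᵀ * M = 1)
  have hs (i : Fin 3) : 0 ≤ sval X i := Real.sqrt_nonneg _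
  have h10 : sval X 1 ≤ sval X 0 := sval_antitone X (by decide)
  have h21 : sval X 2 ≤ sval X 1 := sval_antitone X (by decide)
  have hBd := hdet hB
  have hWd := hdet hW
  have hX : X = B * diagonal (sval X) * Wᵀ := by
    rw [← hXB, Matrix.mul_assoc, (mem_orthogonalGroup_iff _ _).1 hW, Matrix.mul_one]
  have hsign : Real.sign X.det * sval X 2 = B.det * W.det * sval X 2 := by
    rcases (hs 2).eq_or_lt with h0 | h0
    · simp [← h0]
    · have hXd : X.det = B.det * W.det * (sval X 0 * sval X 1 * sval X 2) := by
        conv_lhs => rw [hX]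
        simp [Fin.prod_univ_three]
        ring
      have hp : 0 < sval X 0 * sval X 1 * sval X 2 := by
        have : 0 < sval X 1 := by linarith
        have : 0 < sval X 0 := by linarith
        positivity
      have hBW : B.det * W.det = 1 ∨ B.det * W.det = -1 := by
        rw [← mul_self_eq_one_iff]
        linear_combination W.det * W.det * hBd + hWd
      rcases hBW with h | h <;> rw [hXd, h]
      · rw [one_mul, Real.sign_of_pos hp]
      · rw [Real.sign_of_neg (by linarith)]
  refine ⟨_, mul_diagonal_det_mem hB hBd, _,
    transpose_mem_specialOrthogonalGroup (mul_diagonal_det_mem hW hWd),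
    sval X 0, sval X 1, B.det * W.det * sval X 2, h10, ?_, ?_, ?_, ?_⟩
  · rwa [abs_mul, abs_of_nonneg (hs 2), ← Real.sqrt_mul_self_eq_abs,
      show B.det * W.det * (B.det * W.det) = 1 by
        linear_combination W.det * W.det * hBd + hWd, Real.sqrt_one, one_mul]
  · have hD : diagonal ![1, 1, B.det] * diagonal ![sval X 0, sval X 1, B.det * W.det * sval X 2] *
        diagonal ![1, 1, W.det] = diagonal (sval X) := by
      rw [diagonal_mul_diagonal, diagonal_mul_diagonal]
      congr 1
      ext i
      fin_cases i
      · simp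
      · simp
      · simp
        linear_combination sval X 2 * W.det * W.det * hBd + sval X 2 * hWd
    rw [transpose_mul, diagonal_transpose]
    conv_lhs => rw [hX, ← hD]
    simp only [Matrix.mul_assoc]
  · rw [normPlus, hsign]
  · rw [normMinus, hsign]

lemma trace_transpose_mul_rotation_le (X : Matrix (Fin 3) (Fin 3) ℝ)
    {R : Matrix (Fin 3) (Fin 3) ℝ} (hR : R ∈ specialOrthogonalGroup (Fin 3) ℝ) :
    (Xᵀ * R).trace ≤ normPlus X := by
  obtain ⟨U, hU, V, hV, a, b, c, hab, hbc, hX, hp, -⟩ := exists_rotation_svd X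
  have : (Xᵀ * R).trace = (diagonal ![a, b, c] * (Uᵀ * R * Vᵀ)).trace := by
    rw [hX, transpose_mul, transpose_mul, diagonal_transpose, Matrix.mul_assoc, trace_mul_comm]
    simp only [Matrix.mul_assoc]
  rw [this, hp]
  exact trace_diagonal_mul_le hab hbc (mul_mem (mul_mem (transpose_mem_specialOrthogonalGroup hU) hR)
    (transpose_mem_specialOrthogonalGroup hV))

lemma exists_rotation_trace_eq (X : Matrix (Fin 3) (Fin 3) ℝ) :
    ∃ R ∈ specialOrthogonalGroup (Fin 3) ℝ, (Xᵀ * R).trace = normPlus X := by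
  obtain ⟨U, hU, V, hV, a, b, c, -, -, hX, hp, -⟩ := exists_rotation_svd X
  refine ⟨U * V, mul_mem hU hV, ?_⟩
  have hU' : Uᵀ * U = 1 := (mem_orthogonalGroup_iff' _ _).1 (mem_specialOrthogonalGroup_iff.1 hU).1
  have hV' : V * Vᵀ = 1 := (mem_orthogonalGroup_iff _ _).1 (mem_specialOrthogonalGroup_iff.1 hV).1
  have : Xᵀ * (U * V) = Vᵀ * (diagonal ![a, b, c] * V) := by
    rw [hX, transpose_mul, transpose_mul, diagonal_transpose]
    calc _ = Vᵀ * (diagonal ![a, b, c] * ((Uᵀ * U) * V)) := by simp only [Matrix.mul_assoc]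
      _ = _ := by rw [hU', Matrix.one_mul]
  rw [this, trace_mul_comm, Matrix.mul_assoc, hV', Matrix.mul_one, hp]
  simp [Fin.sum_univ_three]

lemma trace_transpose_mul_le (X Y : Matrix (Fin 3) (Fin 3) ℝ) :
    (Xᵀ * Y).trace ≤ normPlus X * normMinus Y := by
  obtain ⟨U, hU, V, hV, a, b, c, hab, hbc, hY, -, hm⟩ := exists_rotation_svd Y
  have key (d : Fin 3 → ℝ) (hd : ∀ i, d i * d i = 1) (hp : ∏ i, d i = 1) :
      (Xᵀ * (U * diagonal d * V)).trace ≤ normPlus X :=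
    trace_transpose_mul_rotation_le X
      (mul_mem (mul_mem hU (diagonal_mem_specialOrthogonalGroup hd hp)) hV)
  have k0 := key ![1, 1, 1] (by simp [Fin.forall_fin_succ]) (by simp [Fin.prod_univ_three])
  have k1 := key ![1, -1, -1] (by simp [Fin.forall_fin_succ]) (by simp [Fin.prod_univ_three])
  have k2 := key ![-1, 1, -1] (by simp [Fin.forall_fin_succ]) (by simp [Fin.prod_univ_three])
  have hdec : diagonal ![a, b, c] = ((a + b) / 2) • diagonal ![1, 1, 1] +
      ((a - c) / 2) • diagonal ![1, -1, -1] + ((b - c) / 2) • diagonal ![-1, 1, -1] := by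
    rw [← diagonal_smul, ← diagonal_smul, ← diagonal_smul, diagonal_add, diagonal_add]
    congr 1
    ext i
    fin_cases i <;> simp <;> ring
  have htr : (Xᵀ * Y).trace = (a + b) / 2 * (Xᵀ * (U * diagonal ![1, 1, 1] * V)).trace +
      (a - c) / 2 * (Xᵀ * (U * diagonal ![1, -1, -1] * V)).trace +
      (b - c) / 2 * (Xᵀ * (U * diagonal ![-1, 1, -1] * V)).trace := by
    rw [hY, hdec]
    simp only [Matrix.mul_add, Matrix.add_mul, Matrix.mul_smul, Matrix.smul_mul, trace_add,
      trace_smul, smul_eq_mul]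
  obtain ⟨h1, h2⟩ := abs_le.1 hbc
  rw [htr, hm]
  calc _ ≤ (a + b) / 2 * normPlus X + (a - c) / 2 * normPlus X + (b - c) / 2 * normPlus X := by
        gcongr <;> linarith
    _ = _ := by ring

lemma normMinus_pos {Y : Matrix (Fin 3) (Fin 3) ℝ} (hY : Y ≠ 0) : 0 < normMinus Y := by
  obtain ⟨U, -, V, -, a, b, c, hab, hbc, hYe, -, hm⟩ := exists_rotation_svd Y
  obtain ⟨h1, h2⟩ := abs_le.1 hbc
  rw [hm]
  by_contra! hle
  obtain rfl : a = 0 := by linarith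
  obtain rfl : b = 0 := by linarith
  obtain rfl : c = 0 := by linarith
  refine hY (hYe.trans ?_)
  have : diagonal ![(0 : ℝ), 0, 0] = 0 := by
    ext i j
    fin_cases i <;> fin_cases j <;> simp
  simp [this]

lemma sval_congr {X Y : Matrix (Fin 3) (Fin 3) ℝ} (h : Xᵀ * X = Yᵀ * Y) : sval X = sval Y := by
  unfold sval
  congr! 6

lemma normPlus_neg (X : Matrix (Fin 3) (Fin 3) ℝ) : normPlus (-X) = normMinus X := by
  rw [normPlus, normMinus, sval_congr (show (-X)ᵀ * -X = Xᵀ * X by simp),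
    det_neg, Fintype.card_fin]
  rw [show (-1 : ℝ) ^ 3 * X.det = -X.det by ring, Real.sign_neg]
  ring

lemma normMinus_neg (X : Matrix (Fin 3) (Fin 3) ℝ) : normMinus (-X) = normPlus X := by
  rw [← normPlus_neg, neg_neg]

lemma normMinus_rotation {R : Matrix (Fin 3) (Fin 3) ℝ}
    (hR : R ∈ specialOrthogonalGroup (Fin 3) ℝ) : normMinus R = 1 := by
  have hR' := mem_specialOrthogonalGroup_iff.1 hR
  have h : Rᵀ * R = 1 := (mem_orthogonalGroup_iff' _ _).1 hR'.1
  have hs (i : Fin 3) : sval R i = 1 := by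
    have hi := (isHermitian_tr_mul_self R).eigenvalues_mem_spectrum_real
      (Tuple.sort (isHermitian_tr_mul_self R).eigenvalues i.rev)
    rw [show spectrum ℝ (Rᵀ * R) = {1} by rw [h, spectrum.one_eq], Set.mem_singleton_iff] at hi
    rw [sval, hi, Real.sqrt_one]
  rw [normMinus, hs, hs, hs, hR'.2, Real.sign_one]
  norm_num

lemma isGreatest_normPlus (X : Matrix (Fin 3) (Fin 3) ℝ) :
    IsGreatest ((fun Y => (Xᵀ * Y).trace / normMinus Y) ''
      {Y : Matrix (Fin 3) (Fin 3) ℝ | Y ≠ 0}) (normPlus X) := by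
  constructor
  · obtain ⟨R, hR, h⟩ := exists_rotation_trace_eq X
    refine ⟨R, ?_, by simp only [h, normMinus_rotation hR, div_one]⟩
    rintro rfl
    simpa using (mem_specialOrthogonalGroup_iff.1 hR).2
  · rintro _ ⟨Y, hY, rfl⟩
    exact (div_le_iff₀ (normMinus_pos hY)).2 (trace_transpose_mul_le X Y)

/-- Duality of the asymmetric norms `‖·‖₊` and `‖·‖₋`. -/
theorem stmt17 (X : Matrix (Fin 3) (Fin 3) ℝ) :
    normPlus X = sSup ((fun Y => (Xᵀ * Y).trace / normMinus Y) ''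
        {Y : Matrix (Fin 3) (Fin 3) ℝ | Y ≠ 0}) ∧
    normMinus X = sSup ((fun Y => (Xᵀ * Y).trace / normPlus Y) ''
        {Y : Matrix (Fin 3) (Fin 3) ℝ | Y ≠ 0}) := by
  refine ⟨(isGreatest_normPlus X).csSup_eq.symm, ?_⟩
  rw [← normPlus_neg, ← (isGreatest_normPlus (-X)).csSup_eq]
  congr 1
  ext r
  constructor
  all_goals
    rintro ⟨Y, hY, rfl⟩
    exact ⟨-Y, neg_ne_zero.2 hY, by simp [normMinus_neg, normPlus_neg]⟩

end BellCorr
end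

section
/- (Achievable singular values) Let A, B ∈ M_{m,3}(ℝ) and r := min{rank A, rank B}. For any real numbers s_1 ≥ s_2 ≥ … ≥ s_r ≥ 0 there exists a real m×m matrix Z such that the singular values of the 3×3 matrix AᵀZB are exactly s_1, …, s_r together with 3 − r zeros. Moreover, when r = 3 and s_3 > 0, for each choice of sign ε ∈ {+1, −1} there exists such a Z additionally satisfying sgn(det(AᵀZB)) = ε. -/
open Matrix Kronecker
open scoped ENNReal ComplexOrder

namespace BellCorr

/-- Two monotone tuples with the same multiset of values coincide. -/
lemma eq_of_monotone_of_map_univ_eq {n : ℕ} {f g : Fin n → ℝ} (hf : Monotone f)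
    (hg : Monotone g)
    (h : Multiset.map f Finset.univ.val = Multiset.map g Finset.univ.val) : f = g := by
  rw [Fin.univ_val_map, Fin.univ_val_map, Multiset.coe_eq_coe] at h
  exact List.ofFn_injective
    (h.eq_of_pairwise' hf.sortedLE_ofFn.pairwise hg.sortedLE_ofFn.pairwise)

/-- The singular values of `U * diagonal d * Vᵀ` with `U`, `V` orthogonal and `|d|` antitone are
the absolute values of the entries of `d`. -/
lemma sval_mul_diagonal_mul_transpose {U V : Matrix (Fin 3) (Fin 3) ℝ} (hU : Uᵀ * U = 1)
    (hV : Vᵀ * V = 1) {d : Fin 3 → ℝ} (hd : Antitone fun i => |d i|) (i : Fin 3) :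
    sval (U * diagonal d * Vᵀ) i = |d i| := by
  set X := U * diagonal d * Vᵀ with hX
  have hXX : Xᵀ * X = V * diagonal (fun i => d i ^ 2) * Vᵀ := by
    calc Xᵀ * X = V * diagonal d * (Uᵀ * U) * diagonal d * Vᵀ := by
          simp only [hX, transpose_mul, transpose_transpose, diagonal_transpose, Matrix.mul_assoc]
      _ = V * (diagonal d * diagonal d) * Vᵀ := by
          rw [hU, Matrix.mul_one, Matrix.mul_assoc V]
      _ = _ := by simp only [diagonal_mul_diagonal, pow_two]
  have hmap : Multiset.map (isHermitian_tr_mul_self X).eigenvalues Finset.univ.val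
      = Multiset.map (fun i => d i ^ 2) Finset.univ.val := by
    have h1 := (isHermitian_tr_mul_self X).roots_charpoly_eq_eigenvalues
    have hchar : (Xᵀ * X).charpoly = ∏ i, (Polynomial.X - Polynomial.C (d i ^ 2)) := by
      rw [hXX, charpoly_mul_comm, ← Matrix.mul_assoc, hV, Matrix.one_mul, charpoly_diagonal]
    rw [hchar, Polynomial.roots_prod _ _ (by
        exact Finset.prod_ne_zero_iff.2 fun i _ => Polynomial.X_sub_C_ne_zero _)] at h1
    simp only [Polynomial.roots_X_sub_C, Multiset.bind_singleton] at h1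
    exact h1.symm
  have key : (isHermitian_tr_mul_self X).eigenvalues ∘
      Tuple.sort (isHermitian_tr_mul_self X).eigenvalues =
      (fun i => d i ^ 2) ∘ (Fin.revPerm : Equiv.Perm (Fin 3)) := by
    refine eq_of_monotone_of_map_univ_eq (Tuple.monotone_sort _) (fun a b hab => ?_) ?_
    · exact sq_le_sq.2 (hd (Fin.rev_le_rev.2 hab))
    · have hperm : ∀ (f : Fin 3 → ℝ) (σ : Equiv.Perm (Fin 3)),
          Multiset.map (f ∘ σ) Finset.univ.val = Multiset.map f Finset.univ.val := fun f σ => by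
        rw [Fin.univ_val_map, Fin.univ_val_map, Multiset.coe_eq_coe]
        exact σ.ofFn_comp_perm f
      rw [hperm, hperm, hmap]
  have := congrFun key i.rev
  simp only [Function.comp_apply, Fin.revPerm_apply, Fin.rev_rev] at this
  rw [sval, this, Real.sqrt_sq_eq_abs]

/-- The row space of a real matrix contains the leading `rank` columns of an orthogonal matrix. -/
lemma exists_orthogonal_transpose_mul {m n : ℕ} (A : Matrix (Fin m) (Fin n) ℝ) :
    ∃ (U : Matrix (Fin n) (Fin n) ℝ) (P : Matrix (Fin m) (Fin n) ℝ), Uᵀ * U = 1 ∧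
      ∀ d : Fin n → ℝ, (∀ i : Fin n, A.rank ≤ (i : ℕ) → d i = 0) →
        Aᵀ * P * diagonal d = U * diagonal d := by
  have hH : (Aᵀ * A).IsHermitian := by
    simpa [conjTranspose_eq_transpose_of_trivial] using isHermitian_conjTranspose_mul_self A
  have hrank : A.rank = Fintype.card {i // hH.eigenvalues i ≠ 0} := by
    rw [← rank_transpose_mul_self, hH.rank_eq_card_non_zero_eigs]
  have hle : A.rank ≤ n := by simpa using A.rank_le_width
  have hcard : Fintype.card {i : Fin n // (i : ℕ) < A.rank} =
      Fintype.card {i // hH.eigenvalues i ≠ 0} := by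
    rw [← hrank, Fintype.card_subtype]
    simpa [Fin.card_filter_val_lt] using hle
  let e := Fintype.equivOfCardEq hcard
  let σ : Equiv.Perm (Fin n) := e.extendSubtype
  have hσ : ∀ i : Fin n, (i : ℕ) < A.rank → hH.eigenvalues (σ i) ≠ 0 :=
    fun i hi => e.extendSubtype_mem i hi
  let W : Matrix (Fin n) (Fin n) ℝ := hH.eigenvectorUnitary
  have hW : Wᵀ * W = 1 := by
    simpa [W, star_eq_conjTranspose, conjTranspose_eq_transpose_of_trivial] using
      Unitary.coe_star_mul_self hH.eigenvectorUnitary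
  let U := W.submatrix id σ
  let μ : Fin n → ℝ := hH.eigenvalues ∘ σ
  have hAU : Aᵀ * A * U = U * diagonal μ := by
    ext i j
    have h := congrFun (hH.mulVec_eigenvectorBasis (σ j)) i
    rw [mul_diagonal]
    simpa [U, W, μ, mul_apply, mulVec, dotProduct, mul_comm] using h
  refine ⟨U, A * U * diagonal μ⁻¹, ?_, fun d hd => ?_⟩
  · have h : Uᵀ * U = (Wᵀ * W).submatrix σ σ := by
      ext i j
      simp [U, mul_apply]
    rw [h, hW, submatrix_one_equiv]
  · rw [← Matrix.mul_assoc, ← Matrix.mul_assoc, hAU, Matrix.mul_assoc, Matrix.mul_assoc,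
      diagonal_mul_diagonal, diagonal_mul_diagonal]
    congr 2
    funext i
    rcases lt_or_ge (i : ℕ) A.rank with hi | hi
    · simp [μ, mul_inv_cancel_left₀ (hσ i hi)]
    · simp [hd i hi]

/-- Simultaneous diagonal parametrization of the matrices `Aᵀ * Z * B`. -/
lemma exists_transpose_mul_mul_eq {m n : ℕ} (A B : Matrix (Fin m) (Fin n) ℝ) :
    ∃ U V : Matrix (Fin n) (Fin n) ℝ, Uᵀ * U = 1 ∧ Vᵀ * V = 1 ∧
      ∀ d : Fin n → ℝ, (∀ i : Fin n, min A.rank B.rank ≤ (i : ℕ) → d i = 0) →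
        ∃ Z : Matrix (Fin m) (Fin m) ℝ, Aᵀ * Z * B = U * diagonal d * Vᵀ := by
  obtain ⟨U, P, hU, hP⟩ := exists_orthogonal_transpose_mul A
  obtain ⟨V, Q, hV, hQ⟩ := exists_orthogonal_transpose_mul B
  refine ⟨U, V, hU, hV, fun d hd => ⟨P * diagonal d * Qᵀ, ?_⟩⟩
  have hQd := congrArg transpose (hQ d fun i hi => hd i (min_le_of_right_le hi))
  simp only [transpose_mul, transpose_transpose, diagonal_transpose] at hQd
  calc Aᵀ * (P * diagonal d * Qᵀ) * B = Aᵀ * P * diagonal d * (Qᵀ * B) := by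
        simp only [Matrix.mul_assoc]
    _ = U * (diagonal d * (Qᵀ * B)) := by
        rw [hP d fun i hi => hd i (min_le_of_left_le hi), Matrix.mul_assoc]
    _ = U * diagonal d * Vᵀ := by rw [hQd, Matrix.mul_assoc]

lemma det_eq_one_or_neg_one_of_transpose_mul_self {n : ℕ} {U : Matrix (Fin n) (Fin n) ℝ}
    (hU : Uᵀ * U = 1) : U.det = 1 ∨ U.det = -1 := by
  have h := congrArg det hU
  rw [det_mul, det_transpose, det_one] at h
  exact mul_self_eq_one_iff.1 h

/-- Achievable singular values of `AᵀZB`: any antitone nonnegative tuple supported on the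
first `r = min{rank A, rank B}` entries is realized, and when `r = 3` and `s₃ > 0` the sign
of `det(AᵀZB)` can be chosen arbitrarily. -/
theorem stmt18 {m : ℕ} (A B : Matrix (Fin m) (Fin 3) ℝ)
    (s : Fin 3 → ℝ) (hmono : Antitone s) (hpos : ∀ i, 0 ≤ s i)
    (hzero : ∀ i : Fin 3, min A.rank B.rank ≤ (i : ℕ) → s i = 0) :
    (∃ Z : Matrix (Fin m) (Fin m) ℝ, ∀ i, sval (Aᵀ * Z * B) i = s i) ∧
    (min A.rank B.rank = 3 → 0 < s 2 → ∀ ε : ℝ, ε = 1 ∨ ε = -1 →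
      ∃ Z : Matrix (Fin m) (Fin m) ℝ, (∀ i, sval (Aᵀ * Z * B) i = s i) ∧
        Real.sign (Aᵀ * Z * B).det = ε) := by
  obtain ⟨U, V, hU, hV, hZ⟩ := exists_transpose_mul_mul_eq A B
  have habs : ∀ i, |s i| = s i := fun i => abs_of_nonneg (hpos i)
  refine ⟨?_, fun hr hs ε hε => ?_⟩
  · obtain ⟨Z, hZ⟩ := hZ s hzero
    refine ⟨Z, fun i => ?_⟩
    rw [hZ, sval_mul_diagonal_mul_transpose hU hV (by simpa only [habs] using hmono), habs]
  · set δ : ℝ := ε * U.det * V.det with hδ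
    have hdU := det_eq_one_or_neg_one_of_transpose_mul_self hU
    have hdV := det_eq_one_or_neg_one_of_transpose_mul_self hV
    have hδabs : |δ| = 1 := by
      rcases hε with h | h <;> rcases hdU with hu | hu <;> rcases hdV with hv | hv <;>
        simp [hδ, h, hu, hv]
    have hδdet : U.det * δ * V.det = ε := by
      rcases hdU with hu | hu <;> rcases hdV with hv | hv <;> simp [hδ, hu, hv]
    let d : Fin 3 → ℝ := ![s 0, s 1, δ * s 2]
    have hd : ∀ i, |d i| = s i := by
      intro i
      fin_cases i <;> simp [d, habs, abs_mul, hδabs]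
    obtain ⟨Z, hZ⟩ := hZ d fun i hi => absurd (hr ▸ hi) (by omega)
    refine ⟨Z, fun i => ?_, ?_⟩
    · rw [hZ, sval_mul_diagonal_mul_transpose hU hV (by simpa only [hd] using hmono), hd]
    · have hprod : 0 < s 0 * s 1 * s 2 :=
        mul_pos (mul_pos (hs.trans_le (hmono (by decide))) (hs.trans_le (hmono (by decide)))) hs
      have hdet : (Aᵀ * Z * B).det = ε * (s 0 * s 1 * s 2) := by
        rw [hZ, det_mul, det_mul, det_transpose, det_diagonal, Fin.prod_univ_three, ← hδdet]
        simp only [d, cons_val_zero, cons_val_one, cons_val]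
        ring
      rw [hdet]
      rcases hε with rfl | rfl
      · rw [one_mul, Real.sign_of_pos hprod]
      · rw [neg_one_mul, Real.sign_of_neg (neg_neg_of_pos hprod)]

end BellCorr
end
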